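/- Let R be a Gorenstein ring and M a non-free, unmixed maximal R-module. Then the Auslander dual M^× belongs to the module-liaison class of M; more precisely, M is directly linked by C = F ⊕ F^* to M^× ⊕ F (where F → M is a minimal free epimorphism), and hence M and M^× are linked in an odd number of steps. -/

import Mathlib

open CategoryTheory Opposite

noncomputable section

universe u

/-- The Ext modules `Ext^n_R(M, N)`. -/
noncomputable def RExt (R : Type) [CommRing R] (M N : ModuleCat R) (n : ℕ) : ModuleCat R :=
  ((Ext R (ModuleCat R) n).obj (op M)).obj N

/-- The (Krull) dimension of a module, i.e. the dimension of `R / Ann M`. -/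
noncomputable def mDim (R : Type) [CommRing R] (M : Type) [AddCommGroup M] [Module R M] :
    WithBot (WithTop ℕ) :=
  ringKrullDim (R ⧸ Module.annihilator R M)

/-- A (local) Gorenstein ring: Noetherian, local, and of finite self-injective dimension
(expressed via vanishing of `Ext^i(-, R)` for large `i`). -/
def IsGorensteinRing (R : Type) [CommRing R] : Prop :=
  IsNoetherianRing R ∧ IsLocalRing R ∧
    ∃ n : ℕ, ∀ (N : ModuleCat R) (i : ℕ), n < i →
      Subsingleton (RExt R N (ModuleCat.of R R) i)

/-- A module has finite projective dimension, expressed via vanishing of `Ext^i(M, -)`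
for all large `i`. -/
def HasFiniteProjDim (R : Type) [CommRing R] (M : ModuleCat R) : Prop :=
  ∃ n : ℕ, ∀ (N : ModuleCat R) (i : ℕ), n < i → Subsingleton (RExt R M N i)

/-- A finitely generated module over a Noetherian local ring is Cohen-Macaulay iff its depth
equals its dimension, i.e. `Ext^i(k, M) ≠ 0` forces `i = dim M`. -/
def IsCohenMacaulayMod (R : Type) [CommRing R] [IsLocalRing R] (M : ModuleCat R) : Prop :=
  ∀ i : ℕ,
    Nontrivial (RExt R (ModuleCat.of R (R ⧸ IsLocalRing.maximalIdeal R)) M i) →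
      (i : WithBot (WithTop ℕ)) = mDim R M

/-- A perfect module: Cohen-Macaulay with finite projective dimension. -/
def IsPerfectMod (R : Type) [CommRing R] [IsLocalRing R] (M : ModuleCat R) : Prop :=
  IsCohenMacaulayMod R M ∧ HasFiniteProjDim R M

/-- The "canonical module" `K_M = Ext^c_R(M, R)` of a module of codimension `c`
(in the local case, where no twist is needed). -/
noncomputable def KMod (R : Type) [CommRing R] (M : ModuleCat R) (c : ℕ) : ModuleCat R :=
  RExt R M (ModuleCat.of R R) c

/-- The height of a prime ideal. -/
noncomputable def pHeight (R : Type) [CommRing R] (p : Ideal R) (hp : p.IsPrime) :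
    WithTop ℕ :=
  Order.height (⟨p, hp⟩ : PrimeSpectrum R)

/-- A module is unmixed if all of its associated primes have the same height. -/
def IsUnmixedMod (R : Type) [CommRing R] (M : Type) [AddCommGroup M] [Module R M] : Prop :=
  ∀ p q, ∀ (hp : p ∈ associatedPrimes R M) (hq : q ∈ associatedPrimes R M),
    pHeight R p hp.isPrime = pHeight R q hq.isPrime

/-- A module has pure codimension `c` if all of its associated primes have height `c`. -/
def IsPureCodim (R : Type) [CommRing R] (M : Type) [AddCommGroup M] [Module R M] (c : ℕ) :
    Prop :=
  ∀ p, ∀ hp : p ∈ associatedPrimes R M, pHeight R p hp.isPrime = c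

/-- A quasi-Gorenstein module of codimension `c`: a perfect module isomorphic to its
canonical module (no twist in the local case). -/
def IsQuasiGorenstein (R : Type) [CommRing R] [IsLocalRing R] (M : ModuleCat R) (c : ℕ) :
    Prop :=
  IsPerfectMod R M ∧ mDim R M + (c : WithBot (WithTop ℕ)) = ringKrullDim R ∧
    Nonempty (M ≃ₗ[R] KMod R M c)

/-- A short exact sequence `0 → A → B → C → 0` of modules, given by linear maps. -/
def IsSES (R : Type) [CommRing R] {A B C : Type} [AddCommGroup A] [Module R A]
    [AddCommGroup B] [Module R B] [AddCommGroup C] [Module R C]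
    (f : A →ₗ[R] B) (g : B →ₗ[R] C) : Prop :=
  Function.Injective f ∧ Function.Surjective g ∧ Function.Exact f g

/-- `M` and `N` are directly module-linked by the quasi-Gorenstein module `C` of
codimension `c` (local case): both are unmixed of the same dimension as `C` and there are
the two standard exact sequences `0 → K_N → C → M → 0` and `0 → K_M → C → N → 0`. -/
def DirectlyLinked (R : Type) [CommRing R] [IsLocalRing R] (C M N : ModuleCat R) (c : ℕ) :
    Prop :=
  IsQuasiGorenstein R C c ∧
    IsUnmixedMod R M ∧ IsUnmixedMod R N ∧ mDim R M = mDim R C ∧ mDim R N = mDim R C ∧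
    (∃ (f : KMod R N c →ₗ[R] C) (g : C →ₗ[R] M), IsSES R f g) ∧
    (∃ (f : KMod R M c →ₗ[R] C) (g : C →ₗ[R] N), IsSES R f g)

/-- Being linked in `k` steps. -/
def LinkedChain (R : Type) [CommRing R] [IsLocalRing R] : ℕ → ModuleCat R → ModuleCat R → Prop
  | 0, M, N => Nonempty (M ≃ₗ[R] N)
  | (k + 1), M, N => ∃ (C P : ModuleCat R) (c : ℕ),
      DirectlyLinked R C M P c ∧ LinkedChain R k P N

end

section ExtComparison
open Limits

variable {R : Type} [CommRing R]

instance linearYoneda_rightOp_preservesFiniteColimits (Y : ModuleCat.{0} R) :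
    PreservesFiniteColimits ((linearYoneda R (ModuleCat.{0} R)).obj Y).rightOp := by
  have : PreservesFiniteLimits (((linearYoneda R (ModuleCat.{0} R)).obj Y) ⋙ forget (ModuleCat R)) :=
    inferInstanceAs (PreservesFiniteLimits (yoneda.obj Y))
  have : PreservesFiniteLimits ((linearYoneda R (ModuleCat.{0} R)).obj Y) :=
    preservesFiniteLimits_of_reflects_of_preserves _ (forget (ModuleCat R))
  exact preservesFiniteColimits_rightOp _

/-- `Ext⁰(M, N)` is the module of linear maps. -/
noncomputable def rExtZeroEquiv (M N : ModuleCat.{0} R) : RExt R M N 0 ≃ₗ[R] (M →ₗ[R] N) :=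
  ((((linearYoneda R (ModuleCat.{0} R)).obj N).rightOp.leftDerivedZeroIsoSelf.app M).unop.symm
    ).toLinearEquiv.trans ModuleCat.homLinearEquiv

lemma subsingleton_rExt_iff (M N : ModuleCat.{0} R) (i : ℕ) :
    Subsingleton (RExt R M N i) ↔ Subsingleton (Abelian.Ext M N i) := by
  cases i with
  | zero =>
    rw [(rExtZeroEquiv M N).toEquiv.subsingleton_congr]
    exact (Abelian.Ext.addEquiv₀.trans ModuleCat.homAddEquiv).toEquiv.subsingleton_congr.symm
  | succ i =>
    let P := projectiveResolution M
    rw [RExt, ← ModuleCat.isZero_iff_subsingleton, (P.isoExt (R := R) (i + 1) N).isZero_iff,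
      ← HomologicalComplex.exactAt_iff_isZero_homology,
      HomologicalComplex.exactAt_iff' _ i (i + 1) (i + 2) (by simp) (by simp),
      ShortComplex.moduleCat_exact_iff]
    constructor
    · intro h
      refine subsingleton_of_forall_eq 0 fun e => ?_
      obtain ⟨f, hf, rfl⟩ := P.extMk_surjective e (i + 2) rfl
      rw [P.extMk_eq_zero_iff f (i + 2) rfl hf i rfl]
      exact h f hf
    · intro h f hf
      exact (P.extMk_eq_zero_iff f (i + 2) rfl hf i rfl).mp (Subsingleton.elim _ _)

end ExtComparison

section ExtKilled

variable {R : Type} [CommRing R]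

lemma shortExact_mk_of_linearMap {A B C : Type} [AddCommGroup A] [Module R A]
    [AddCommGroup B] [Module R B] [AddCommGroup C] [Module R C]
    (f : A →ₗ[R] B) (g : B →ₗ[R] C) (hf : Function.Injective f) (hg : Function.Surjective g)
    (hfg : Function.Exact f g) :
    (ModuleCat.shortComplexOfCompEqZero f g hfg.linearMap_comp_eq_zero).ShortExact where
  exact := by
    rw [ShortComplex.ShortExact.moduleCat_exact_iff_function_exact]
    exact hfg
  mono_f := (ModuleCat.mono_iff_injective _).mpr hf
  epi_g := (ModuleCat.epi_iff_surjective _).mpr hg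

/-- The scalar `s` annihilates `Ext^i(N, Y)`. -/
def ExtKilledBy (s : R) (N Y : ModuleCat.{0} R) (i : ℕ) : Prop :=
  ∀ e : Abelian.Ext N Y i, s • e = 0

lemma extKilledBy_one_iff {N Y : ModuleCat.{0} R} {i : ℕ} :
    ExtKilledBy (1 : R) N Y i ↔ Subsingleton (Abelian.Ext N Y i) := by
  refine ⟨fun h => subsingleton_of_forall_eq 0 fun e => ?_, fun h e => Subsingleton.elim _ _⟩
  rw [← h e, one_smul]

lemma ExtKilledBy.of_retract {s : R} {N N' Y : ModuleCat.{0} R} {i : ℕ}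
    (h : ExtKilledBy s N Y i) (a : N' ⟶ N) (b : N ⟶ N') (hab : a ≫ b = 𝟙 N') :
    ExtKilledBy s N' Y i := by
  intro e
  have := congrArg (fun z => (Abelian.Ext.mk₀ a).comp z (zero_add i))
    (h ((Abelian.Ext.mk₀ b).comp e (zero_add i)))
  simpa [hab] using this

lemma extKilledBy_of_mem_annihilator {s : R} {N Y : ModuleCat.{0} R} (i : ℕ)
    (hs : s ∈ Module.annihilator R N) : ExtKilledBy s N Y i := by
  intro e
  have hz : s • 𝟙 N = 0 := by
    ext x
    exact Module.mem_annihilator.mp hs x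
  have : (Abelian.Ext.mk₀ (s • 𝟙 N)).comp e (zero_add i) = 0 := by rw [hz]; simp
  simpa [Abelian.Ext.mk₀_smul] using this

lemma extKilledBy_of_projective (s : R) {N : ModuleCat.{0} R} [Projective N]
    (Y : ModuleCat.{0} R) (i : ℕ) : ExtKilledBy s N Y (i + 1) := by
  intro e
  rw [e.eq_zero_of_projective, smul_zero]

lemma ExtKilledBy.middle {S : ShortComplex (ModuleCat.{0} R)} (hS : S.ShortExact)
    {Y : ModuleCat.{0} R} {i : ℕ} {s t : R} (h₁ : ExtKilledBy s S.X₁ Y i)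
    (h₃ : ExtKilledBy t S.X₃ Y i) : ExtKilledBy (t * s) S.X₂ Y i := by
  intro e
  obtain ⟨x, hx⟩ := Abelian.Ext.contravariant_sequence_exact₂ hS Y (s • e)
    (by rw [Abelian.Ext.comp_smul, h₁])
  rw [mul_smul, ← hx, ← Abelian.Ext.comp_smul, h₃, Abelian.Ext.comp_zero]

lemma ExtKilledBy.left {S : ShortComplex (ModuleCat.{0} R)} (hS : S.ShortExact)
    {Y : ModuleCat.{0} R} {i : ℕ} {s t : R} (h₂ : ExtKilledBy s S.X₂ Y i)
    (h₃ : ExtKilledBy t S.X₃ Y (1 + i)) : ExtKilledBy (s * t) S.X₁ Y i := by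
  intro e
  obtain ⟨x, hx⟩ := Abelian.Ext.contravariant_sequence_exact₁ hS Y (t • e) rfl
    (by rw [Abelian.Ext.comp_smul, h₃])
  rw [mul_smul, ← hx, ← Abelian.Ext.comp_smul, h₂, Abelian.Ext.comp_zero]

lemma exists_extKilledBy_of_forall_prime [IsNoetherianRing R] (S : Submonoid R)
    (Y : ModuleCat.{0} R) (i : ℕ)
    (h : ∀ p : Ideal R, p.IsPrime → ∃ s ∈ S, ExtKilledBy s (ModuleCat.of R (R ⧸ p)) Y i)
    (N : Type) [AddCommGroup N] [Module R N] [Module.Finite R N] :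
    ∃ s ∈ S, ExtKilledBy s (ModuleCat.of R N) Y i := by
  refine IsNoetherianRing.induction_on_isQuotientEquivQuotientPrime R (M := N) inferInstance
    (motive := fun N _ _ _ => ∃ s ∈ S, ExtKilledBy s (ModuleCat.of R N) Y i) ?_ ?_ ?_
  · intro N _ _ _ _
    exact ⟨1, S.one_mem, extKilledBy_of_mem_annihilator i
      (Module.mem_annihilator.mpr fun x => Subsingleton.elim (α := N) _ _)⟩
  · intro N _ _ _ p e
    obtain ⟨s, hs, hk⟩ := h p.asIdeal p.isPrime
    exact ⟨s, hs, hk.of_retract e.toModuleIso.hom e.toModuleIso.inv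
      e.toModuleIso.hom_inv_id⟩
  · rintro N₁ _ _ _ N₂ _ _ _ N₃ _ _ _ f g hf hg hfg ⟨s, hs, hk⟩ ⟨t, ht, hl⟩
    exact ⟨t * s, S.mul_mem ht hs, hk.middle (shortExact_mk_of_linearMap f g hf hg hfg) hl⟩

lemma subsingleton_ext_of_isSMulRegular [IsNoetherianRing R] [IsLocalRing R]
    {N Y : ModuleCat.{0} R} [Module.Finite R N] [Module.Finite R Y] {y : R}
    (hy : y ∈ IsLocalRing.maximalIdeal R) (hreg : IsSMulRegular N y) {i : ℕ}
    (h : Subsingleton (Abelian.Ext (ModuleCat.of R (QuotSMulTop y N)) Y (1 + i))) :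
    Subsingleton (Abelian.Ext N Y i) := by
  have := ModuleCat.finite_ext R N Y i
  rw [← Submodule.subsingleton_iff R, ← subsingleton_iff_bot_eq_top, eq_comm]
  refine Submodule.eq_bot_of_le_smul_of_le_jacobson_bot (Ideal.span {y}) ⊤ Module.Finite.fg_top
    ?_ ?_
  · intro e _
    obtain ⟨x, hx⟩ := Abelian.Ext.contravariant_sequence_exact₁ hreg.smulShortComplex_shortExact
      Y e rfl (h.elim _ _)
    change (Abelian.Ext.mk₀ (y • 𝟙 N)).comp (show Abelian.Ext N Y i from x) (zero_add i) = e at hx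
    rw [Abelian.Ext.mk₀_smul, Abelian.Ext.smul_comp, Abelian.Ext.mk₀_id_comp] at hx
    rw [← hx]
    exact Submodule.smul_mem_smul (Ideal.mem_span_singleton_self y) trivial
  · rw [IsLocalRing.jacobson_eq_maximalIdeal _ bot_ne_top, Ideal.span_singleton_le_iff_mem]
    exact hy

lemma isSMulRegular_quotient_prime {p : Ideal R} [p.IsPrime] {y : R} (hy : y ∉ p) :
    IsSMulRegular (R ⧸ p) y := by
  have : (Ideal.Quotient.mk p y) ≠ 0 := by rwa [Ne, Ideal.Quotient.eq_zero_iff_mem]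
  intro a b hab
  simp only [Algebra.smul_def, Ideal.Quotient.algebraMap_eq] at hab
  exact mul_left_cancel₀ this hab

end ExtKilled

section Bass

open RingTheory.Sequence IsLocalRing

variable {R : Type} [CommRing R] [IsLocalRing R]

lemma IsLocalRing.mem_maximalIdeal_of_isRegular {rs : List R} (hrs : IsRegular R rs) :
    ∀ r ∈ rs, r ∈ maximalIdeal R := by
  intro r hr
  refine IsLocalRing.le_maximalIdeal (J := Ideal.ofList rs) ?_ (Ideal.subset_span hr)
  exact fun h => hrs.top_ne_smul (by rw [h, Submodule.top_smul])

variable [IsNoetherianRing R]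

lemma length_le_ringKrullDim_of_isRegular {rs : List R} (hrs : IsRegular R rs) :
    (rs.length : WithBot ℕ∞) ≤ ringKrullDim R := by
  rw [← ringKrullDim_add_length_eq_ringKrullDim_of_isRegular rs hrs]
  have : Nontrivial (R ⧸ Ideal.ofList rs) := Ideal.Quotient.nontrivial_iff.mpr fun h =>
    hrs.top_ne_smul (by rw [h, Submodule.top_smul])
  exact le_add_of_nonneg_left ringKrullDim_nonneg_of_nontrivial

variable (R) in
lemma exists_isRegular_maximal_length :
    ∃ rs : List R, IsRegular R rs ∧ ∀ rs' : List R, IsRegular R rs' → rs'.length ≤ rs.length := by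
  obtain ⟨d, hd⟩ : ∃ d : ℕ, ringKrullDim R = d := by
    rw [← maximalIdeal_height_eq_ringKrullDim]
    obtain ⟨d, hd⟩ := ENat.ne_top_iff_exists.mp
      (Ideal.height_ne_top (I := maximalIdeal R) Ideal.IsPrime.ne_top')
    exact ⟨d, by rw [← hd]; rfl⟩
  have hbdd : ∀ n, (∃ rs : List R, IsRegular R rs ∧ rs.length = n) → n ≤ d := by
    rintro n ⟨rs, hrs, rfl⟩
    have := length_le_ringKrullDim_of_isRegular hrs
    rw [hd] at this
    exact_mod_cast this
  classical
  have hnil : ∃ rs : List R, IsRegular R rs ∧ rs.length = 0 := ⟨[], IsRegular.nil R R, rfl⟩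
  obtain ⟨rs, hrs, hlen⟩ := Nat.findGreatest_spec
    (P := fun n => ∃ rs : List R, IsRegular R rs ∧ rs.length = n) (Nat.zero_le d) hnil
  refine ⟨rs, hrs, fun rs' hrs' => ?_⟩
  rw [hlen]
  exact Nat.le_findGreatest (hbdd _ ⟨rs', hrs', rfl⟩) ⟨rs', hrs', rfl⟩

lemma exists_injective_residueField_of_maximal_length {rs : List R} (hrs : IsRegular R rs)
    (hmax : ∀ rs' : List R, IsRegular R rs' → rs'.length ≤ rs.length) :
    ∃ f : (R ⧸ maximalIdeal R) →ₗ[R] (R ⧸ Ideal.ofList rs • (⊤ : Submodule R R)),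
      Function.Injective f := by
  have hne : ¬ Subsingleton
      ((R ⧸ maximalIdeal R) →ₗ[R] (R ⧸ Ideal.ofList rs • (⊤ : Submodule R R))) := by
    rw [IsSMulRegular.subsingleton_linearMap_iff]
    rintro ⟨x, hx, hreg⟩
    rw [Ideal.annihilator_quotient] at hx
    have hmem : ∀ r ∈ rs ++ [x], r ∈ maximalIdeal R := by
      intro r hr
      rcases List.mem_append.mp hr with h | h
      · exact mem_maximalIdeal_of_isRegular hrs r h
      · rwa [List.mem_singleton.mp h]
    have := hmax (rs ++ [x]) ((isRegular_iff_isWeaklyRegular_of_subset_maximalIdeal hmem).mpr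
      ((isWeaklyRegular_append_iff R rs [x]).mpr ⟨hrs.toIsWeaklyRegular,
        (isWeaklyRegular_singleton_iff _ x).mpr hreg⟩))
    simp at this
  rw [not_subsingleton_iff_nontrivial] at hne
  obtain ⟨f, hf⟩ := exists_ne
    (0 : (R ⧸ maximalIdeal R) →ₗ[R] (R ⧸ Ideal.ofList rs • (⊤ : Submodule R R)))
  refine ⟨f, ?_⟩
  have : IsSimpleModule R (R ⧸ maximalIdeal R) :=
    isSimpleModule_iff_isCoatom.mpr (maximalIdeal.isMaximal R).out
  exact f.injective_or_eq_zero.resolve_right hf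

lemma extKilledBy_quotient_ofList {rs : List R} (hrs : IsRegular R rs) (Y : ModuleCat.{0} R)
    {i : ℕ} (hi : rs.length < i) :
    ExtKilledBy (1 : R) (ModuleCat.of R (R ⧸ Ideal.ofList rs • (⊤ : Submodule R R))) Y i := by
  have hpd : HasProjectiveDimensionLT (ModuleCat.of R (Shrink.{0} (R ⧸ Ideal.ofList rs)))
      (rs.length + 1) := by
    rw [← projectiveDimension_lt_iff, ModuleCat.projectiveDimension_quotient_eq_length rs hrs]
    exact_mod_cast Nat.lt_succ_self _
  have hk : ExtKilledBy (1 : R) (ModuleCat.of R (Shrink.{0} (R ⧸ Ideal.ofList rs))) Y i := by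
    intro e
    rw [e.eq_zero_of_hasProjectiveDimensionLT (rs.length + 1) hi, smul_zero]
  let e : (R ⧸ Ideal.ofList rs • (⊤ : Submodule R R)) ≃ₗ[R] Shrink.{0} (R ⧸ Ideal.ofList rs) :=
    (Submodule.quotEquivOfEq _ _ (by simp)).trans (Shrink.linearEquiv R _).symm
  exact hk.of_retract e.toModuleIso.hom e.toModuleIso.inv e.toModuleIso.hom_inv_id

lemma subsingleton_ext_quotient_prime {Y : ModuleCat.{0} R} [Module.Finite R Y] {i : ℕ}
    (h : ∀ (N : Type) [AddCommGroup N] [Module R N] [Module.Finite R N],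
      ExtKilledBy (1 : R) (ModuleCat.of R N) Y (i + 1))
    {p : Ideal R} [p.IsPrime] (hp : p ≠ maximalIdeal R) :
    Subsingleton (Abelian.Ext (ModuleCat.of R (R ⧸ p)) Y i) := by
  obtain ⟨y, hy, hyp⟩ : ∃ y ∈ maximalIdeal R, y ∉ p := by
    by_contra! hle
    exact hp (le_antisymm (le_maximalIdeal Ideal.IsPrime.ne_top') hle)
  refine subsingleton_ext_of_isSMulRegular hy (isSMulRegular_quotient_prime hyp) ?_
  rw [add_comm]
  exact extKilledBy_one_iff.mp (h _)

lemma subsingleton_ext_of_length_lt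
    (hR : ∃ n : ℕ, ∀ (N : ModuleCat.{0} R) (i : ℕ), n < i →
      Subsingleton (Abelian.Ext N (ModuleCat.of R R) i))
    {rs : List R} (hrs : IsRegular R rs)
    (hmax : ∀ rs' : List R, IsRegular R rs' → rs'.length ≤ rs.length)
    {i : ℕ} (hi : rs.length < i) (N : Type) [AddCommGroup N] [Module R N] [Module.Finite R N] :
    ExtKilledBy (1 : R) (ModuleCat.of R N) (ModuleCat.of R R) i := by
  obtain ⟨n, hn⟩ := hR
  obtain ⟨k, hk⟩ : ∃ k, n < i + k := ⟨n + 1, by omega⟩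
  induction k generalizing i N with
  | zero => exact extKilledBy_one_iff.mpr (hn _ _ hk)
  | succ k ih =>
    have key : ∀ p : Ideal R, p.IsPrime →
        ExtKilledBy (1 : R) (ModuleCat.of R (R ⧸ p)) (ModuleCat.of R R) i := by
      intro p hp
      by_cases hpm : p = maximalIdeal R
      · subst hpm
        obtain ⟨f, hf⟩ := exists_injective_residueField_of_maximal_length hrs hmax
        have := ExtKilledBy.left (shortExact_mk_of_linearMap f (LinearMap.range f).mkQ hf
          (Submodule.mkQ_surjective _) (LinearMap.exact_map_mkQ_range f))
          (extKilledBy_quotient_ofList hrs (ModuleCat.of R R) hi)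
          (ih (i := 1 + i) (by omega) _ (by omega))
        rwa [mul_one] at this
      · exact extKilledBy_one_iff.mpr (subsingleton_ext_quotient_prime
          (fun N _ _ _ => ih (i := i + 1) (by omega) N (by omega)) hpm)
    obtain ⟨s, hs, h⟩ := exists_extKilledBy_of_forall_prime (⊥ : Submonoid R) (ModuleCat.of R R) i
      (fun p hp => ⟨1, Submonoid.mem_bot.mpr rfl, key p hp⟩) N
    rwa [Submonoid.mem_bot.mp hs] at h

lemma ringKrullDim_eq_length_of_maximal_length
    (hR : ∃ n : ℕ, ∀ (N : ModuleCat.{0} R) (i : ℕ), n < i →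
      Subsingleton (Abelian.Ext N (ModuleCat.of R R) i))
    {rs : List R} (hrs : IsRegular R rs)
    (hmax : ∀ rs' : List R, IsRegular R rs' → rs'.length ≤ rs.length) :
    ringKrullDim R = rs.length := by
  refine le_antisymm ?_ (length_le_ringKrullDim_of_isRegular hrs)
  have key : ∀ p : Ideal R, p.IsPrime → Ideal.ofList rs ≤ p → p = maximalIdeal R := by
    intro p hp hle
    by_contra hpm
    have hlt : p • (⊤ : Submodule R (ModuleCat.of R R)) < ⊤ := by
      rw [lt_top_iff_ne_top]
      change p • (⊤ : Ideal R) ≠ ⊤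
      simpa using hp.ne_top
    have hsupp : Module.support R (ModuleCat.of R (R ⧸ p)) = PrimeSpectrum.zeroLocus p := by
      rw [Module.support_eq_zeroLocus]
      change PrimeSpectrum.zeroLocus (Module.annihilator R (R ⧸ p) : Set R) = _
      rw [Ideal.annihilator_quotient]
    obtain ⟨rs', hlen, -, hreg⟩ := ModuleCat.exists_isRegular_of_exists_subsingleton_ext p
      (rs.length + 1) (ModuleCat.of R R) hlt (ModuleCat.of R (R ⧸ p)) hsupp (by
        intro i hi
        rcases Nat.lt_succ_iff_lt_or_eq.mp hi with hi | rfl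
        · exact ModuleCat.subsingleton_ext_of_exists_isRegular p (ModuleCat.of R (R ⧸ p))
            hsupp.le (ModuleCat.of R R) hlt rs (fun r hr => hle (Ideal.subset_span hr)) hrs i hi
        · exact subsingleton_ext_quotient_prime
            (fun N _ _ _ => subsingleton_ext_of_length_lt hR hrs hmax (Nat.lt_succ_self _) N) hpm)
    have := hmax rs' hreg
    omega
  have hmin : maximalIdeal R ∈ (Ideal.ofList rs).minimalPrimes := by
    refine ⟨⟨inferInstance, Ideal.span_le.mpr (mem_maximalIdeal_of_isRegular hrs)⟩,
      fun q hq _ => (key q hq.1 hq.2).ge⟩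
  classical
  have hspan : Ideal.ofList rs = Ideal.span (rs.toFinset : Set R) := by
    simp [Ideal.ofList]
  rw [hspan] at hmin
  rw [← maximalIdeal_height_eq_ringKrullDim]
  have := (Ideal.height_le_card_of_mem_minimalPrimes_span_finset hmin).trans
    (Nat.cast_le.mpr (List.toFinset_card_le rs))
  exact_mod_cast this

end Bass

section AssociatedPrimes

open RingTheory.Sequence IsLocalRing
open scoped Pointwise

variable {R : Type} [CommRing R]

lemma ringKrullDim_quotient_succ_le {p q : Ideal R} [p.IsPrime] (hpq : p ≤ q) {a : R}
    (hap : a ∉ p) (haq : a ∈ q) : ringKrullDim (R ⧸ q) + 1 ≤ ringKrullDim (R ⧸ p) := by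
  refine ringKrullDim_succ_le_of_surjective (Ideal.Quotient.factor hpq)
    (Ideal.Quotient.factor_surjective hpq) (r := Ideal.Quotient.mk p a) ?_ ?_
  · rwa [mem_nonZeroDivisors_iff_ne_zero, Ne, Ideal.Quotient.eq_zero_iff_mem]
  · rwa [Ideal.Quotient.factor_mk, Ideal.Quotient.eq_zero_iff_mem]

lemma IsSMulRegular.notMem_of_mem_associatedPrimes [IsNoetherianRing R] {A : Type}
    [AddCommGroup A] [Module R A] {a : R} (ha : IsSMulRegular A a) {p : Ideal R}
    (hp : p ∈ associatedPrimes R A) : a ∉ p := by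
  obtain ⟨hprime, f, hf⟩ := (isAssociatedPrime_iff_exists_injective_linearMap p A).mp hp
  intro hap
  have h0 : a • f 1 = a • 0 := by
    rw [← map_smul, smul_zero, Algebra.smul_def, mul_one, Ideal.Quotient.algebraMap_eq,
      Ideal.Quotient.eq_zero_iff_mem.mpr hap, map_zero]
  have h1 := hf ((ha h0).trans (map_zero f).symm)
  exact hprime.ne_top ((Ideal.eq_top_iff_one p).mpr (Ideal.Quotient.eq_zero_iff_mem.mp h1))

lemma exists_associatedPrime_quotSMulTop [IsNoetherianRing R] [IsLocalRing R] {A : Type}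
    [AddCommGroup A] [Module R A] [Module.Finite R A] {a : R} (ham : a ∈ maximalIdeal R)
    (ha : IsSMulRegular A a) {p : Ideal R} (hp : p ∈ associatedPrimes R A) :
    ∃ q ∈ associatedPrimes R (QuotSMulTop a A), p ≤ q ∧ a ∈ q := by
  obtain ⟨hprime, f, hf⟩ := (isAssociatedPrime_iff_exists_injective_linearMap p A).mp hp
  obtain ⟨z, hz, hza⟩ : ∃ z ∈ Submodule.torsionBySet R A p, z ∉ a • (⊤ : Submodule R A) := by
    by_contra! hle
    have hbot : Submodule.torsionBySet R A (p : Set R) = ⊥ := by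
      refine Submodule.eq_bot_of_le_smul_of_le_jacobson_bot (Ideal.span {a}) _
        (IsNoetherian.noetherian _) (fun z hz => ?_) ?_
      · obtain ⟨w, -, rfl⟩ := hle z hz
        refine Submodule.smul_mem_smul (Ideal.mem_span_singleton_self a) ?_
        rw [Submodule.mem_torsionBySet_iff] at hz ⊢
        intro r
        refine ha ?_
        change a • (r : R) • w = a • 0
        rw [smul_zero, smul_comm]
        exact hz r
      · rw [IsLocalRing.jacobson_eq_maximalIdeal _ bot_ne_top, Ideal.span_singleton_le_iff_mem]
        exact ham
    have hmem : f 1 ∈ Submodule.torsionBySet R A (p : Set R) := by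
      rw [Submodule.mem_torsionBySet_iff]
      intro r
      rw [← map_smul, Algebra.smul_def, mul_one, Ideal.Quotient.algebraMap_eq,
        Ideal.Quotient.eq_zero_iff_mem.mpr r.2, map_zero]
    rw [hbot, Submodule.mem_bot] at hmem
    have h1 := hf (hmem.trans (map_zero f).symm)
    exact hprime.ne_top ((Ideal.eq_top_iff_one p).mpr (Ideal.Quotient.eq_zero_iff_mem.mp h1))
  obtain ⟨q, hq, hle⟩ := exists_le_isAssociatedPrime_of_isNoetherianRing R
    (M := QuotSMulTop a A) ((a • (⊤ : Submodule R A)).mkQ z)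
    (by rwa [Ne, Submodule.mkQ_apply, Submodule.Quotient.mk_eq_zero])
  refine ⟨q, hq, fun r hr => hle ?_, hle ?_⟩
  · rw [Submodule.mem_colon_singleton, ← map_smul,
      (Submodule.mem_torsionBySet_iff _ _).mp hz ⟨r, hr⟩, map_zero]
    exact Submodule.zero_mem _
  · rw [Submodule.mem_colon_singleton, ← map_smul, Submodule.mem_bot, Submodule.mkQ_apply,
      Submodule.Quotient.mk_eq_zero]
    exact Submodule.smul_mem_pointwise_smul z a ⊤ trivial

lemma length_le_ringKrullDim_of_mem_associatedPrimes [IsNoetherianRing R] [IsLocalRing R]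
    {rs : List R} (hmem : ∀ r ∈ rs, r ∈ maximalIdeal R) {A : Type} [AddCommGroup A] [Module R A]
    [Module.Finite R A] (hrs : IsWeaklyRegular A rs) {p : Ideal R}
    (hp : p ∈ associatedPrimes R A) : (rs.length : WithBot ℕ∞) ≤ ringKrullDim (R ⧸ p) := by
  induction rs generalizing A p with
  | nil =>
    have := hp.isPrime
    exact_mod_cast ringKrullDim_nonneg_of_nontrivial
  | cons a rs ih =>
    rw [isWeaklyRegular_cons_iff] at hrs
    have := hp.isPrime
    obtain ⟨q, hq, hpq, haq⟩ :=
      exists_associatedPrime_quotSMulTop (hmem a List.mem_cons_self) hrs.1 hp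
    refine le_trans ?_ (ringKrullDim_quotient_succ_le hpq
      (hrs.1.notMem_of_mem_associatedPrimes hp) haq)
    rw [List.length_cons, Nat.cast_succ]
    exact add_le_add_left (ih (fun r hr => hmem r (List.mem_cons_of_mem a hr)) hrs.2 hq) 1

variable [IsNoetherianRing R]

lemma isMin_of_mem_associatedPrimes_ring [IsLocalRing R] {rs : List R} (hrs : IsRegular R rs)
    (hdim : ringKrullDim R = rs.length) {p : Ideal R} (hp : p ∈ associatedPrimes R R) :
    IsMin (⟨p, hp.isPrime⟩ : PrimeSpectrum R) := by
  rintro ⟨q, hq⟩ hqp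
  by_contra hpq
  obtain ⟨y, hyp, hyq⟩ : ∃ y ∈ p, y ∉ q := by
    by_contra! hle
    exact hpq hle
  have h₁ := ringKrullDim_quotient_succ_le (p := q) (q := p) hqp hyq hyp
  have h₂ := length_le_ringKrullDim_of_mem_associatedPrimes
    (mem_maximalIdeal_of_isRegular hrs) hrs.toIsWeaklyRegular hp
  have h₃ := ((add_le_add_left h₂ 1).trans h₁).trans (ringKrullDim_quotient_le q)
  rw [hdim] at h₃
  have : rs.length + 1 ≤ rs.length := by exact_mod_cast h₃
  omega

lemma mem_associatedPrimes_ring_of_isMin {p : PrimeSpectrum R} (hp : IsMin p) :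
    p.asIdeal ∈ associatedPrimes R R := by
  refine Module.associatedPrimes.minimalPrimes_annihilator_subset_associatedPrimes R R
    ⟨⟨p.isPrime, ?_⟩, fun q hq hqp => hp (b := ⟨q, hq.1⟩) hqp⟩
  rw [Module.annihilator_eq_bot.mpr inferInstance]
  exact bot_le

/-- Every nonzero element is detected by a linear form. -/
def IsTorsionless (R : Type) [CommRing R] (N : Type) [AddCommGroup N] [Module R N] : Prop :=
  ∀ x : N, (∀ f : Module.Dual R N, f x = 0) → x = 0

lemma IsTorsionless.associatedPrimes_subset {N : Type} [AddCommGroup N] [Module R N]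
    [Module.Finite R N] (hN : IsTorsionless R N) :
    associatedPrimes R N ⊆ associatedPrimes R R := by
  intro p hp
  obtain ⟨hprime, x, hx⟩ := isAssociatedPrime_iff.mp hp
  obtain ⟨S, hS⟩ := (Module.Finite.fg_top : (⊤ : Submodule R (Module.Dual R N)).FG)
  let K : Module.Dual R N → Ideal R := fun f => (⊥ : Submodule R R).colon {f x}
  have hinf : S.inf K ≤ p := by
    intro r hr
    rw [Submodule.mem_finsetInf] at hr
    rw [hx, Submodule.mem_colon_singleton, Submodule.mem_bot]
    refine hN _ fun f => ?_
    have hf : f ∈ Submodule.span R (S : Set (Module.Dual R N)) := hS ▸ trivial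
    induction hf using Submodule.span_induction with
    | mem f hf =>
      have := Submodule.mem_colon_singleton.mp (hr f hf)
      rwa [Submodule.mem_bot, ← map_smul] at this
    | zero => rfl
    | add f g _ _ hf hg => rw [LinearMap.add_apply, hf, hg, add_zero]
    | smul c f _ hf => rw [LinearMap.smul_apply, hf, smul_zero]
  obtain ⟨f, -, hf⟩ := (Ideal.IsPrime.inf_le' hprime).mp hinf
  refine isAssociatedPrime_iff.mpr ⟨hprime, f x, le_antisymm (fun r hr => ?_) hf⟩
  rw [hx, Submodule.mem_colon_singleton, Submodule.mem_bot] at hr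
  rw [Submodule.mem_colon_singleton, Submodule.mem_bot, ← map_smul, hr, map_zero]

lemma IsTorsionless.isUnmixedMod [IsLocalRing R] {rs : List R} (hrs : IsRegular R rs)
    (hdim : ringKrullDim R = rs.length) {N : Type} [AddCommGroup N] [Module R N]
    [Module.Finite R N] (hN : IsTorsionless R N) : IsUnmixedMod R N := by
  intro p q hp hq
  rw [pHeight, pHeight,
    Order.height_eq_zero.mpr (isMin_of_mem_associatedPrimes_ring hrs hdim
      (hN.associatedPrimes_subset hp)),
    Order.height_eq_zero.mpr (isMin_of_mem_associatedPrimes_ring hrs hdim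
      (hN.associatedPrimes_subset hq))]

lemma IsTorsionless.mDim_eq [IsLocalRing R] {rs : List R} (hrs : IsRegular R rs)
    (hdim : ringKrullDim R = rs.length) {N : Type} [AddCommGroup N] [Module R N]
    [Module.Finite R N] [Nontrivial N] (hN : IsTorsionless R N) : mDim R N = ringKrullDim R := by
  refine le_antisymm (ringKrullDim_quotient_le _) ?_
  obtain ⟨p, hp⟩ := associatedPrimes.nonempty R N
  rw [hdim]
  refine (length_le_ringKrullDim_of_mem_associatedPrimes (mem_maximalIdeal_of_isRegular hrs)
    hrs.toIsWeaklyRegular (hN.associatedPrimes_subset hp)).trans ?_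
  exact ringKrullDim_le_of_surjective (Ideal.Quotient.factor
    (Submodule.annihilator_top.symm.trans_le hp.annihilator_le))
    (Ideal.Quotient.factor_surjective _)

end AssociatedPrimes

section MaximalUnmixed

variable {R : Type} [CommRing R] [IsNoetherianRing R]

lemma exists_isMin_mem_associatedPrimes {d : ℕ} (hdim : ringKrullDim R = d) {M : Type}
    [AddCommGroup M] [Module R M] [Module.Finite R M] (hM : mDim R M = ringKrullDim R) :
    ∃ p : PrimeSpectrum R, IsMin p ∧ p.asIdeal ∈ associatedPrimes R M := by
  have hd : (d : WithBot ℕ∞) ≤ Order.krullDim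
      (PrimeSpectrum.zeroLocus (Module.annihilator R M : Set R)) := by
    rw [← ringKrullDim_quotient, ← hdim, ← hM, mDim]
  obtain ⟨l, hl⟩ := Order.le_krullDim_iff.mp hd
  have hmin : IsMin (l.head : PrimeSpectrum R) := by
    intro q hq
    by_contra hlt
    let l' : LTSeries (PrimeSpectrum R) :=
      (l.map Subtype.val (Subtype.strictMono_coe _)).cons q
        (by rw [LTSeries.head_map]; exact lt_of_le_not_ge hq hlt)
    have := Order.LTSeries.length_le_krullDim l'
    rw [← ringKrullDim, hdim] at this
    have : l'.length ≤ d := by exact_mod_cast this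
    simp [l', hl] at this
  refine ⟨l.head, hmin, ?_⟩
  exact Module.associatedPrimes.minimalPrimes_annihilator_subset_associatedPrimes R M
    ⟨⟨(l.head : PrimeSpectrum R).isPrime, l.head.2⟩, fun q hq hqp => hmin (b := ⟨q, hq.1⟩) hqp⟩

lemma isMin_of_mem_associatedPrimes {d : ℕ} (hdim : ringKrullDim R = d) {M : Type}
    [AddCommGroup M] [Module R M] [Module.Finite R M] (hM : mDim R M = ringKrullDim R)
    (hunmixed : IsUnmixedMod R M) {p : Ideal R} (hp : p ∈ associatedPrimes R M) :
    IsMin (⟨p, hp.isPrime⟩ : PrimeSpectrum R) := by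
  obtain ⟨q, hmin, hq⟩ := exists_isMin_mem_associatedPrimes hdim hM
  rw [← Order.height_eq_zero]
  exact (hunmixed p q.asIdeal hp hq).trans (Order.height_eq_zero.mpr hmin)

lemma exists_extKilledBy_notMem_of_isMin
    (hR : ∃ n : ℕ, ∀ (N : ModuleCat.{0} R) (i : ℕ), n < i →
      Subsingleton (Abelian.Ext N (ModuleCat.of R R) i))
    {p : PrimeSpectrum R} (hp : IsMin p) (i : ℕ) (N : Type) [AddCommGroup N] [Module R N]
    [Module.Finite R N] :
    ∃ s ∈ p.asIdeal.primeCompl,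
      ExtKilledBy s (ModuleCat.of R N) (ModuleCat.of R R) (i + 1) := by
  obtain ⟨n, hn⟩ := hR
  obtain ⟨k, hk⟩ : ∃ k, n < i + 1 + k := ⟨n + 1, by omega⟩
  induction k generalizing i N with
  | zero => exact ⟨1, Submonoid.one_mem _, extKilledBy_one_iff.mpr (hn _ _ hk)⟩
  | succ k ih =>
    refine exists_extKilledBy_of_forall_prime _ _ _ (fun q hq => ?_) N
    by_cases hqp : q ≤ p.asIdeal
    · obtain rfl : q = p.asIdeal := le_antisymm hqp (hp (b := ⟨q, hq⟩) hqp)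
      obtain ⟨-, f, hf⟩ := (isAssociatedPrime_iff_exists_injective_linearMap _ R).mp
        (mem_associatedPrimes_ring_of_isMin hp)
      obtain ⟨s, hs, h⟩ := ih (i + 1) (R ⧸ LinearMap.range f) (by omega)
      have hproj : Projective (ModuleCat.of R R) :=
        (IsProjective.iff_projective R).mp inferInstance
      refine ⟨1 * s, Submonoid.mul_mem _ (Submonoid.one_mem _) hs, ?_⟩
      refine ExtKilledBy.left (shortExact_mk_of_linearMap f (LinearMap.range f).mkQ hf
        (Submodule.mkQ_surjective _) (LinearMap.exact_map_mkQ_range f))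
        (extKilledBy_of_projective (N := ModuleCat.of R R) 1 _ i) ?_
      rw [add_comm]
      exact h
    · obtain ⟨s, hsq, hsp⟩ := Set.not_subset.mp hqp
      exact ⟨s, hsp, extKilledBy_of_mem_annihilator _ (by
        change s ∈ Module.annihilator R (R ⧸ q)
        rwa [Ideal.annihilator_quotient])⟩

lemma isTorsionless_of_forall_isMin
    (hR : ∃ n : ℕ, ∀ (N : ModuleCat.{0} R) (i : ℕ), n < i →
      Subsingleton (Abelian.Ext N (ModuleCat.of R R) i))
    {M : Type} [AddCommGroup M] [Module R M] [Module.Finite R M]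
    (hM : ∀ p, ∀ hp : p ∈ associatedPrimes R M, IsMin (⟨p, hp.isPrime⟩ : PrimeSpectrum R)) :
    IsTorsionless R M := by
  let T : Submodule R M := ⨅ f : Module.Dual R M, LinearMap.ker f
  have hT : T = ⊥ := by
    by_contra hne
    have : Nontrivial T := Submodule.nontrivial_iff_ne_bot.mpr hne
    obtain ⟨p, hp⟩ := associatedPrimes.nonempty R T
    have hpM := associatedPrimes.subset_of_injective T.injective_subtype hp
    obtain ⟨hprime, f, hf⟩ := (isAssociatedPrime_iff_exists_injective_linearMap p T).mp hp
    obtain ⟨-, g, hg⟩ := (isAssociatedPrime_iff_exists_injective_linearMap p R).mp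
      (mem_associatedPrimes_ring_of_isMin (hM p hpM))
    let i := T.subtype ∘ₗ f
    have hi : Function.Injective i := T.injective_subtype.comp hf
    obtain ⟨s, hs, hk⟩ := exists_extKilledBy_notMem_of_isMin hR (hM p hpM) 0
      (M ⧸ LinearMap.range i)
    have hS := shortExact_mk_of_linearMap i (LinearMap.range i).mkQ hi
      (Submodule.mkQ_surjective _) (LinearMap.exact_map_mkQ_range i)
    obtain ⟨x, hx⟩ := Abelian.Ext.contravariant_sequence_exact₁ hS (ModuleCat.of R R)
      (Abelian.Ext.mk₀ (s • ModuleCat.ofHom g)) (n₁ := 1) rfl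
      (by rw [Abelian.Ext.mk₀_smul, Abelian.Ext.comp_smul]; exact hk _)
    obtain ⟨h, rfl⟩ := Abelian.Ext.addEquiv₀.symm.surjective x
    have hcomp : ModuleCat.ofHom i ≫ h = s • ModuleCat.ofHom g := by
      apply Abelian.Ext.addEquiv₀.symm.injective
      simpa using hx
    have hval := congrArg (fun φ => φ.hom (1 : R ⧸ p)) hcomp
    have hzero : h.hom (i 1) = 0 := by
      have hmem : (f 1 : M) ∈ T := (f 1).2
      simp only [T, Submodule.mem_iInf] at hmem
      exact hmem h.hom
    have hsg : g (s • 1) = g 0 := by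
      rw [map_smul, map_zero]
      exact hval.symm.trans hzero
    refine hs (Ideal.Quotient.eq_zero_iff_mem.mp ?_)
    simpa [Algebra.smul_def] using hg hsg
  intro x hx
  have : x ∈ T := by simpa [T, Submodule.mem_iInf] using hx
  rwa [hT, Submodule.mem_bot] at this

end MaximalUnmixed

section Linkage

open RingTheory.Sequence IsLocalRing

variable {R : Type} [CommRing R]

lemma isTorsionless_of_free (F : Type) [AddCommGroup F] [Module R F] [Module.Free R F] :
    IsTorsionless R F := by
  intro x hx
  let b := Module.Free.chooseBasis R F
  exact b.ext_elem fun i => by simpa using hx (b.coord i)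

lemma IsTorsionless.prod {A B : Type} [AddCommGroup A] [Module R A] [AddCommGroup B] [Module R B]
    (hA : IsTorsionless R A) (hB : IsTorsionless R B) : IsTorsionless R (A × B) := by
  rintro ⟨a, b⟩ h
  exact Prod.ext (hA a fun f => h (f ∘ₗ LinearMap.fst R A B))
    (hB b fun f => h (f ∘ₗ LinearMap.snd R A B))

lemma subsingleton_ext_of_free {X : ModuleCat.{0} R} {i : ℕ}
    (h : Subsingleton (Abelian.Ext X (ModuleCat.of R R) i)) (C : Type) [AddCommGroup C]
    [Module R C] [Module.Free R C] [Module.Finite R C] :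
    Subsingleton (Abelian.Ext X (ModuleCat.of R C) i) := by
  refine subsingleton_of_forall_eq 0 fun e => ?_
  let b := Module.Free.chooseBasis R C
  let Φ : (ModuleCat.of R C ⟶ ModuleCat.of R C) →+ Abelian.Ext X (ModuleCat.of R C) i :=
    AddMonoidHom.mk' (fun φ => e.comp (Abelian.Ext.mk₀ φ) (add_zero i))
      (fun φ ψ => by rw [Abelian.Ext.mk₀_add, Abelian.Ext.comp_add])
  have hid : 𝟙 (ModuleCat.of R C) = ∑ j, ModuleCat.ofHom (b.coord j) ≫
      ModuleCat.ofHom (LinearMap.toSpanSingleton R C (b j)) := by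
    ext x
    simp [ModuleCat.hom_sum, b.sum_repr x]
  have hΦ : e = Φ (𝟙 _) := by simp [Φ]
  rw [hΦ, hid, map_sum]
  refine Finset.sum_eq_zero fun j _ => ?_
  change e.comp (Abelian.Ext.mk₀ _) (add_zero i) = 0
  rw [← Abelian.Ext.mk₀_comp_mk₀, ← Abelian.Ext.comp_assoc_of_third_deg_zero,
    h.elim (e.comp _ _) 0, Abelian.Ext.zero_comp]

lemma IsSES.precomp_equiv {A A' B C : Type} [AddCommGroup A] [Module R A] [AddCommGroup A']
    [Module R A'] [AddCommGroup B] [Module R B] [AddCommGroup C] [Module R C]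
    {f : A →ₗ[R] B} {g : B →ₗ[R] C} (h : IsSES R f g) (e : A' ≃ₗ[R] A) :
    IsSES R (f ∘ₗ e.toLinearMap) g := by
  refine ⟨h.1.comp e.injective, h.2.1, fun y => ?_⟩
  rw [h.2.2 y, LinearMap.coe_comp]
  exact (e.surjective.range_comp f).symm ▸ Iff.rfl

variable [IsNoetherianRing R] [IsLocalRing R]

lemma subsingleton_ext_residueField
    (hR : ∃ n : ℕ, ∀ (N : ModuleCat.{0} R) (i : ℕ), n < i →
      Subsingleton (Abelian.Ext N (ModuleCat.of R R) i))
    {rs : List R} (hrs : IsRegular R rs)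
    (hmax : ∀ rs' : List R, IsRegular R rs' → rs'.length ≤ rs.length)
    {i : ℕ} (hi : i ≠ rs.length) :
    Subsingleton (Abelian.Ext (ModuleCat.of R (R ⧸ maximalIdeal R)) (ModuleCat.of R R) i) := by
  rcases hi.lt_or_gt with hi | hi
  · refine ModuleCat.subsingleton_ext_of_exists_isRegular (maximalIdeal R) _ ?_ _ ?_ rs
      (mem_maximalIdeal_of_isRegular hrs) hrs i hi
    · rw [Module.support_eq_zeroLocus]
      change PrimeSpectrum.zeroLocus (Module.annihilator R (R ⧸ maximalIdeal R) : Set R) ⊆ _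
      rw [Ideal.annihilator_quotient]
    · rw [lt_top_iff_ne_top]
      change maximalIdeal R • (⊤ : Ideal R) ≠ ⊤
      simpa using Ideal.IsPrime.ne_top'
  · exact extKilledBy_one_iff.mp (subsingleton_ext_of_length_lt hR hrs hmax hi _)

lemma isQuasiGorenstein_of_free
    (hR : ∃ n : ℕ, ∀ (N : ModuleCat.{0} R) (i : ℕ), n < i →
      Subsingleton (Abelian.Ext N (ModuleCat.of R R) i))
    {rs : List R} (hrs : IsRegular R rs)
    (hmax : ∀ rs' : List R, IsRegular R rs' → rs'.length ≤ rs.length)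
    (C : Type) [AddCommGroup C] [Module R C] [Module.Free R C] [Module.Finite R C]
    [Nontrivial C] : IsQuasiGorenstein R (ModuleCat.of R C) 0 := by
  have hdim := ringKrullDim_eq_length_of_maximal_length hR hrs hmax
  have hC : mDim R C = ringKrullDim R := (isTorsionless_of_free C).mDim_eq hrs hdim
  refine ⟨⟨fun i hi => ?_, 0, fun N i hi => ?_⟩, ?_, ?_⟩
  · change _ = mDim R C
    rw [hC, hdim]
    by_contra hne
    have hne : i ≠ rs.length := fun h => hne (by rw [h]; rfl)
    refine not_subsingleton_iff_nontrivial.mpr hi ?_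
    rw [subsingleton_rExt_iff]
    exact subsingleton_ext_of_free (subsingleton_ext_residueField hR hrs hmax hne) C
  · rw [subsingleton_rExt_iff, ← extKilledBy_one_iff]
    have : Projective (ModuleCat.of R C) := (IsProjective.iff_projective C).mp inferInstance
    obtain ⟨i, rfl⟩ := Nat.exists_eq_succ_of_ne_zero hi.ne'
    exact extKilledBy_of_projective 1 N i
  · rw [← hC]
    exact add_zero _
  · classical
    exact ⟨((Module.Free.chooseBasis R C).toDualEquiv).trans
      (rExtZeroEquiv (ModuleCat.of R C) (ModuleCat.of R R)).symm⟩

lemma directlyLinked_of_free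
    (hR : ∃ n : ℕ, ∀ (N : ModuleCat.{0} R) (i : ℕ), n < i →
      Subsingleton (Abelian.Ext N (ModuleCat.of R R) i))
    (C M N : Type) [AddCommGroup C] [Module R C] [AddCommGroup M] [Module R M]
    [AddCommGroup N] [Module R N] [Module.Free R C] [Module.Finite R C] [Nontrivial C]
    [Module.Finite R M] [Nontrivial M] (hM : IsTorsionless R M)
    [Module.Finite R N] [Nontrivial N] (hN : IsTorsionless R N)
    {f : Module.Dual R N →ₗ[R] C} {g : C →ₗ[R] M} (hfg : IsSES R f g)
    {f' : Module.Dual R M →ₗ[R] C} {g' : C →ₗ[R] N} (hfg' : IsSES R f' g') :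
    DirectlyLinked R (ModuleCat.of R C) (ModuleCat.of R M) (ModuleCat.of R N) 0 := by
  obtain ⟨rs, hrs, hmax⟩ := exists_isRegular_maximal_length R
  have hdim := ringKrullDim_eq_length_of_maximal_length hR hrs hmax
  have hC := (isTorsionless_of_free (R := R) C).mDim_eq hrs hdim
  exact ⟨isQuasiGorenstein_of_free hR hrs hmax C, hM.isUnmixedMod hrs hdim,
    hN.isUnmixedMod hrs hdim, (hM.mDim_eq hrs hdim).trans hC.symm,
    (hN.mDim_eq hrs hdim).trans hC.symm,
    ⟨_, g, hfg.precomp_equiv (rExtZeroEquiv (ModuleCat.of R N) (ModuleCat.of R R))⟩,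
    ⟨_, g', hfg'.precomp_equiv (rExtZeroEquiv (ModuleCat.of R M) (ModuleCat.of R R))⟩⟩

end Linkage

section AuslanderDual

variable {R : Type} [CommRing R] {F M : Type} [AddCommGroup F] [Module R F] [AddCommGroup M]
  [Module R M] {π : F →ₗ[R] M}

lemma isTorsionless_auslanderDual (hπ : Function.Surjective π) :
    IsTorsionless R (Module.Dual R F ⧸ LinearMap.range π.dualMap) := by
  intro x hx
  obtain ⟨φ, rfl⟩ := Submodule.mkQ_surjective _ x
  rw [Submodule.mkQ_apply, Submodule.Quotient.mk_eq_zero,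
    LinearMap.range_dualMap_eq_dualAnnihilator_ker_of_surjective π hπ,
    Submodule.mem_dualAnnihilator]
  intro y hy
  have hle : LinearMap.range π.dualMap ≤ LinearMap.ker (Module.Dual.eval R F y) := by
    rintro _ ⟨ψ, rfl⟩
    simp [LinearMap.mem_ker.mp hy]
  simpa using hx ((LinearMap.range π.dualMap).liftQ _ hle)

lemma nontrivial_auslanderDual [Module.Free R F] (hM : ¬ Module.Free R M)
    (hπ : Function.Surjective π) :
    Nontrivial (Module.Dual R F ⧸ LinearMap.range π.dualMap) := by
  rw [Submodule.Quotient.nontrivial_iff]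
  intro htop
  rw [LinearMap.range_dualMap_eq_dualAnnihilator_ker_of_surjective π hπ] at htop
  have hinj : Function.Injective π := by
    rw [← LinearMap.ker_eq_bot, Submodule.eq_bot_iff]
    intro x hx
    refine isTorsionless_of_free (R := R) F x fun f => ?_
    have hf : f ∈ (LinearMap.ker π).dualAnnihilator := htop ▸ trivial
    exact (Submodule.mem_dualAnnihilator f).mp hf x hx
  exact hM (Module.Free.of_equiv (LinearEquiv.ofBijective π ⟨hinj, hπ⟩))

lemma isSES_dualMap_mkQ (hπ : Function.Surjective π) :
    IsSES R π.dualMap (LinearMap.range π.dualMap).mkQ :=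
  ⟨LinearMap.dualMap_injective_of_surjective hπ, Submodule.mkQ_surjective _,
    LinearMap.exact_map_mkQ_range _⟩

variable [Module.Free R F] [Module.Finite R F]

/-- The dual of the Auslander dual maps to `F`, with image the kernel of `π` when `M` is
torsionless. -/
noncomputable def auslanderDualDualMap (π : F →ₗ[R] M) :
    Module.Dual R (Module.Dual R F ⧸ LinearMap.range π.dualMap) →ₗ[R] F :=
  (Module.evalEquiv R F).symm.toLinearMap ∘ₗ (LinearMap.range π.dualMap).mkQ.dualMap

lemma isSES_auslanderDualDualMap (hπ : Function.Surjective π) (hM : IsTorsionless R M) :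
    IsSES R (auslanderDualDualMap π) π := by
  refine ⟨(Module.evalEquiv R F).symm.injective.comp
    (LinearMap.dualMap_injective_of_surjective (Submodule.mkQ_surjective _)), hπ, fun x => ?_⟩
  constructor
  · intro hx
    have hle : LinearMap.range π.dualMap ≤ LinearMap.ker (Module.Dual.eval R F x) := by
      rintro _ ⟨ψ, rfl⟩
      simp [hx]
    refine ⟨(LinearMap.range π.dualMap).liftQ _ hle, ?_⟩
    refine (LinearEquiv.symm_apply_eq _).mpr ?_
    ext φ
    simp
  · rintro ⟨θ, rfl⟩
    refine hM _ fun ψ => ?_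
    have h := LinearMap.congr_fun ((Module.evalEquiv R F).apply_symm_apply
      ((LinearMap.range π.dualMap).mkQ.dualMap θ)) (π.dualMap ψ)
    have h0 : (LinearMap.range π.dualMap).mkQ (π.dualMap ψ) = 0 := by simp
    rw [LinearMap.dualMap_apply, h0, map_zero] at h
    exact h

end AuslanderDual

/-- Let `M` be a non-free, unmixed maximal module over a Gorenstein
ring.  Then `M` is directly linked by `C = F ⊕ F^*` (where `π : F → M` is a minimal free
epimorphism) to `M^× ⊕ F`, where `M^×` is the Auslander dual of `M`; hence `M` and `M^×`
are linked in an odd number of steps, so `M^×` lies in the module-liaison class of `M`.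
(Local case.) -/
theorem auslanderDual_in_liaison_class
    (R : Type) [CommRing R] [IsLocalRing R] (hGor : IsGorensteinRing R)
    (M : ModuleCat R) [Module.Finite R M] (hnf : ¬ Module.Free R M)
    (hunmixed : IsUnmixedMod R M) (hmax : mDim R M = ringKrullDim R)
    (F : ModuleCat R) (hFfree : Module.Free R F) (hFfin : Module.Finite R F)
    (π : F →ₗ[R] M) (hπ : Function.Surjective π)
    (hmin : LinearMap.ker π ≤ (IsLocalRing.maximalIdeal R) • (⊤ : Submodule R F)) :
    DirectlyLinked R (ModuleCat.of R (F × Module.Dual R F)) M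
      (ModuleCat.of R ((Module.Dual R F ⧸ LinearMap.range π.dualMap) × F)) 0 ∧
    ∃ k : ℕ, Odd k ∧ LinkedChain R k M
      (ModuleCat.of R (Module.Dual R F ⧸ LinearMap.range π.dualMap)) := by
  obtain ⟨hnoeth, -, n, hn⟩ := hGor
  have hR : ∃ n : ℕ, ∀ (N : ModuleCat.{0} R) (i : ℕ), n < i →
      Subsingleton (Abelian.Ext N (ModuleCat.of R R) i) :=
    ⟨n, fun N i hi => (subsingleton_rExt_iff _ _ _).mp (hn N i hi)⟩
  have hMtl : IsTorsionless R M := by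
    obtain ⟨rs, hrs, hlen⟩ := exists_isRegular_maximal_length R
    exact isTorsionless_of_forall_isMin hR fun p hp => isMin_of_mem_associatedPrimes
      (ringKrullDim_eq_length_of_maximal_length hR hrs hlen) hmax hunmixed hp
  have hMnt : Nontrivial M := by
    by_contra h
    rw [not_nontrivial_iff_subsingleton] at h
    exact hnf inferInstance
  have hFnt : Nontrivial F := hπ.nontrivial
  have hAtl := isTorsionless_auslanderDual hπ
  have hAnt := nontrivial_auslanderDual hnf hπ
  have hses := isSES_dualMap_mkQ hπ
  have hses' := isSES_auslanderDualDualMap hπ hMtl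
  refine ⟨?_, 1, odd_one, ?_⟩
  · have h₁ : IsSES R ((auslanderDualDualMap π).prodMap (LinearMap.id (M := Module.Dual R F)))
        (π ∘ₗ LinearMap.fst R F (Module.Dual R F)) := by
      refine ⟨hses'.1.prodMap Function.injective_id, hπ.comp Prod.fst_surjective, ?_⟩
      rintro ⟨x, φ⟩
      simpa [Prod.ext_iff] using hses'.2.2 x
    have h₂ : IsSES R (LinearMap.inr R F (Module.Dual R F) ∘ₗ π.dualMap)
        (((LinearMap.range π.dualMap).mkQ ∘ₗ LinearMap.snd R F (Module.Dual R F)).prod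
          (LinearMap.fst R F (Module.Dual R F))) := by
      refine ⟨LinearMap.inr_injective.comp hses.1, ?_, ?_⟩
      · rintro ⟨a, x⟩
        obtain ⟨φ, rfl⟩ := hses.2.1 a
        exact ⟨(x, φ), rfl⟩
      · rintro ⟨x, φ⟩
        constructor
        · intro h
          obtain ⟨ψ, hψ⟩ := (hses.2.2 φ).mp (congrArg Prod.fst h)
          exact ⟨ψ, Prod.ext (congrArg Prod.snd h).symm hψ⟩
        · rintro ⟨ψ, hψ⟩
          exact Prod.ext ((hses.2.2 φ).mpr ⟨ψ, congrArg Prod.snd hψ⟩)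
            (congrArg Prod.fst hψ).symm
    exact directlyLinked_of_free hR (F × Module.Dual R F) M
      ((Module.Dual R F ⧸ LinearMap.range π.dualMap) × F) hMtl
      (hAtl.prod (isTorsionless_of_free F))
      (h₁.precomp_equiv (Module.dualProdDualEquivDual R _ F).symm) h₂
  · classical
    let e := (Module.Free.chooseBasis R F).toDualEquiv
    have h₂ : IsSES R (e.symm.toLinearMap ∘ₗ π.dualMap)
        ((LinearMap.range π.dualMap).mkQ ∘ₗ e.toLinearMap) := by
      refine ⟨e.symm.injective.comp hses.1, hses.2.1.comp e.surjective, fun x => ?_⟩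
      refine (hses.2.2 (e x)).trans ⟨?_, ?_⟩
      · rintro ⟨ψ, hψ⟩
        exact ⟨ψ, (LinearEquiv.symm_apply_eq e).mpr hψ⟩
      · rintro ⟨ψ, hψ⟩
        exact ⟨ψ, (LinearEquiv.symm_apply_eq e).mp hψ⟩
    exact ⟨ModuleCat.of R F, ModuleCat.of R (Module.Dual R F ⧸ LinearMap.range π.dualMap), 0,
      directlyLinked_of_free hR F M (Module.Dual R F ⧸ LinearMap.range π.dualMap) hMtl hAtl
        hses' h₂, ⟨LinearEquiv.refl R _⟩⟩
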